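/- Let J be a smooth almost complex structure on a neighborhood of 0 in ℂⁿ with J = J_st + O(|Z|), coordinates Z=(z₁,…,z_{n−1},w), and suppose the complex line l = {(0,…,0,ζ) : ζ ∈ ℂ} is J-holomorphic. Then for the non-isotropic dilations Λ_δ(z,w) = (δ⁻¹z, δ^{−1/2}w), the induced structures J_δ := (Λ_δ)_*(J) converge to J_st in C^k norm on every compact subset of ℂⁿ as δ → 0, for every k. -/

import Mathlib

noncomputable section
open Complex Metric

/-- Coordinates `Z = (z₁,…,z_{n−1}, w) ∈ ℂ^{n−1} × ℂ` (here `m = n−1`). -/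
abbrev Em (m : ℕ) := (Fin m → ℂ) × ℂ

/-- The standard complex structure on `ℂ^{m} × ℂ`. -/
def JstE (m : ℕ) : Em m →L[ℝ] Em m :=
  Complex.I • ContinuousLinearMap.id ℝ (Em m)

/-- The non-isotropic dilation `Λ_δ(z,w) = (δ⁻¹ z, δ^{−1/2} w)` as a linear map. -/
def Lam (m : ℕ) (δ : ℝ) : Em m →L[ℝ] Em m :=
  ((δ⁻¹ : ℝ) • ContinuousLinearMap.id ℝ (Fin m → ℂ)).prodMap
    (((Real.sqrt δ)⁻¹ : ℝ) • ContinuousLinearMap.id ℝ ℂ)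

/-- Its inverse `Λ_δ⁻¹(z,w) = (δ z, δ^{1/2} w)`. -/
def LamInv (m : ℕ) (δ : ℝ) : Em m →L[ℝ] Em m :=
  ((δ : ℝ) • ContinuousLinearMap.id ℝ (Fin m → ℂ)).prodMap
    ((Real.sqrt δ : ℝ) • ContinuousLinearMap.id ℝ ℂ)

/-- The induced structure `J_δ = (Λ_δ)_*(J) = dΛ_δ ∘ J(Λ_δ⁻¹ ·) ∘ dΛ_δ⁻¹`. -/
def Jdelta (m : ℕ) (J : Em m → (Em m →L[ℝ] Em m)) (δ : ℝ) (Z : Em m) :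
    Em m →L[ℝ] Em m :=
  (Lam m δ).comp ((J (δ • Z.1, Real.sqrt δ • Z.2)).comp (LamInv m δ))


/-- Conjugation by the dilation, as a continuous linear map. -/
def Qd (m : ℕ) (δ : ℝ) : (Em m →L[ℝ] Em m) →L[ℝ] (Em m →L[ℝ] Em m) :=
  (ContinuousLinearMap.compL ℝ (Em m) (Em m) (Em m) (Lam m δ)).comp
    ((ContinuousLinearMap.compL ℝ (Em m) (Em m) (Em m)).flip (LamInv m δ))

lemma Qd_apply (m : ℕ) (δ : ℝ) (T : Em m →L[ℝ] Em m) :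
    Qd m δ T = (Lam m δ).comp (T.comp (LamInv m δ)) := rfl

lemma LamInv_apply (m : ℕ) (δ : ℝ) (Z : Em m) :
    LamInv m δ Z = (δ • Z.1, Real.sqrt δ • Z.2) := rfl

lemma Lam_apply (m : ℕ) (δ : ℝ) (Z : Em m) :
    Lam m δ Z = (δ⁻¹ • Z.1, (Real.sqrt δ)⁻¹ • Z.2) := rfl

lemma Qd_Jst (m : ℕ) (δ : ℝ) (hδ : 0 < δ) : Qd m δ (JstE m) = JstE m := by
  have hs : Real.sqrt δ ≠ 0 := (Real.sqrt_pos.2 hδ).ne'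
  refine ContinuousLinearMap.ext fun Z => ?_
  rw [Qd_apply]
  simp only [ContinuousLinearMap.comp_apply, LamInv_apply, Lam_apply, JstE,
    ContinuousLinearMap.smul_apply, ContinuousLinearMap.id_apply, Prod.smul_fst, Prod.smul_snd]
  refine Prod.ext ?_ ?_
  · simp only [Prod.smul_fst]
    rw [smul_comm Complex.I δ, inv_smul_smul₀ hδ.ne']
  · simp only [Prod.smul_snd]
    rw [smul_comm Complex.I (Real.sqrt δ), inv_smul_smul₀ hs]

lemma norm_LamInv_le (m : ℕ) (δ : ℝ) (hδ : 0 < δ) (h1 : Real.sqrt δ < 1) :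
    ‖LamInv m δ‖ ≤ Real.sqrt δ := by
  have hs := Real.sqrt_pos.2 hδ
  have hss : Real.sqrt δ * Real.sqrt δ = δ := Real.mul_self_sqrt hδ.le
  refine ContinuousLinearMap.opNorm_le_bound _ hs.le fun Z => ?_
  rw [LamInv_apply, Prod.norm_mk, norm_smul, norm_smul, Real.norm_of_nonneg hδ.le,
    Real.norm_of_nonneg hs.le]
  refine max_le ?_ ?_
  · exact mul_le_mul (by nlinarith) (norm_fst_le Z) (norm_nonneg _) hs.le
  · exact mul_le_mul_of_nonneg_left (norm_snd_le Z) hs.le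

lemma norm_Lam_le (m : ℕ) (δ : ℝ) (hδ : 0 < δ) (h1 : Real.sqrt δ < 1) :
    ‖Lam m δ‖ ≤ δ⁻¹ := by
  have hs := Real.sqrt_pos.2 hδ
  have hss : Real.sqrt δ * Real.sqrt δ = δ := Real.mul_self_sqrt hδ.le
  have hi : 0 < δ⁻¹ := inv_pos.2 hδ
  refine ContinuousLinearMap.opNorm_le_bound _ hi.le fun Z => ?_
  rw [Lam_apply, Prod.norm_mk, norm_smul, norm_smul, Real.norm_of_nonneg hi.le,
    Real.norm_of_nonneg (inv_pos.2 hs).le]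
  refine max_le ?_ ?_
  · exact mul_le_mul_of_nonneg_left (norm_fst_le Z) hi.le
  · exact mul_le_mul (inv_anti₀ hδ (by nlinarith)) (norm_snd_le Z) (norm_nonneg _) hi.le

lemma norm_Qd_apply_le (m : ℕ) (δ : ℝ) (hδ : 0 < δ) (h1 : Real.sqrt δ < 1)
    (T : Em m →L[ℝ] Em m) : ‖Qd m δ T‖ ≤ (Real.sqrt δ)⁻¹ * ‖T‖ := by
  have hs := Real.sqrt_pos.2 hδ
  have hss : Real.sqrt δ * Real.sqrt δ = δ := Real.mul_self_sqrt hδ.le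
  rw [Qd_apply]
  calc _ ≤ ‖Lam m δ‖ * (‖T‖ * ‖LamInv m δ‖) :=
        (ContinuousLinearMap.opNorm_comp_le _ _).trans
          (mul_le_mul_of_nonneg_left (ContinuousLinearMap.opNorm_comp_le _ _) (norm_nonneg _))
    _ ≤ δ⁻¹ * (‖T‖ * Real.sqrt δ) := by
        gcongr
        · exact norm_Lam_le m δ hδ h1
        · exact norm_LamInv_le m δ hδ h1
    _ = (Real.sqrt δ)⁻¹ * ‖T‖ := by
        nth_rewrite 1 [← hss]
        field_simp

lemma norm_Qd_le (m : ℕ) (δ : ℝ) (hδ : 0 < δ) (h1 : Real.sqrt δ < 1) :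
    ‖Qd m δ‖ ≤ (Real.sqrt δ)⁻¹ :=
  ContinuousLinearMap.opNorm_le_bound _ (inv_nonneg.2 (Real.sqrt_nonneg _))
    (norm_Qd_apply_le m δ hδ h1)

/-- If `T` kills the `w`-direction, conjugation does not increase its norm. -/
lemma norm_Qd_apply_le_of_ker (m : ℕ) (δ : ℝ) (hδ : 0 < δ) (h1 : Real.sqrt δ < 1)
    (T : Em m →L[ℝ] Em m) (hT : ∀ c : ℂ, T ((0 : Fin m → ℂ), c) = 0) : ‖Qd m δ T‖ ≤ ‖T‖ := by
  refine ContinuousLinearMap.opNorm_le_bound _ (norm_nonneg _) fun u => ?_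
  have e : LamInv m δ u = δ • (u.1, (0 : ℂ)) + ((0 : Fin m → ℂ), Real.sqrt δ • u.2) := by
    rw [LamInv_apply]; simp
  have e2 : Qd m δ T u = δ • Lam m δ (T (u.1, (0 : ℂ))) := by
    rw [Qd_apply]
    simp only [ContinuousLinearMap.comp_apply]
    rw [e, map_add, hT, add_zero, map_smul, map_smul]
  rw [e2, norm_smul, Real.norm_of_nonneg hδ.le]
  have h3 : ‖Lam m δ (T (u.1, (0 : ℂ)))‖ ≤ δ⁻¹ * (‖T‖ * ‖u‖) := by
    refine (ContinuousLinearMap.le_opNorm _ _).trans ?_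
    refine mul_le_mul (norm_Lam_le m δ hδ h1) ?_ (norm_nonneg _) (inv_pos.2 hδ).le
    refine (ContinuousLinearMap.le_opNorm _ _).trans ?_
    refine mul_le_mul_of_nonneg_left ?_ (norm_nonneg _)
    rw [Prod.norm_mk, norm_zero]
    exact max_le (norm_fst_le u) (norm_nonneg _)
  calc _ ≤ δ * (δ⁻¹ * (‖T‖ * ‖u‖)) := mul_le_mul_of_nonneg_left h3 hδ.le
    _ = ‖T‖ * ‖u‖ := by rw [mul_inv_cancel_left₀ hδ.ne']

lemma Jdelta_sub_eq (m : ℕ) (J : Em m → (Em m →L[ℝ] Em m)) (δ : ℝ) (hδ : 0 < δ) :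
    (fun W => Jdelta m J δ W - JstE m)
      = fun W => Qd m δ (J (LamInv m δ W) - JstE m) := by
  funext W
  rw [map_sub, Qd_Jst m δ hδ]
  rfl

lemma norm_LamInv_apply_le (m : ℕ) (δ : ℝ) (hδ : 0 < δ) (h1 : Real.sqrt δ < 1) {R : ℝ}
    {Z : Em m} (hZ : ‖Z‖ ≤ R) : ‖LamInv m δ Z‖ ≤ Real.sqrt δ * R :=
  (ContinuousLinearMap.le_opNorm _ _).trans
    (mul_le_mul (norm_LamInv_le m δ hδ h1) hZ (norm_nonneg _) (Real.sqrt_nonneg _))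

/-- Derivatives of order at least two. -/
lemma high_order (m : ℕ) (F : Em m → (Em m →L[ℝ] Em m)) (hF : ContDiff ℝ (⊤ : ℕ∞) F)
    (i : ℕ) (R : ℝ) (hR : 0 < R) (ε : ℝ) (hε : 0 < ε) :
    ∃ s₀ > 0, ∀ δ : ℝ, 0 < δ → Real.sqrt δ < s₀ → ∀ Z : Em m, ‖Z‖ ≤ R →
      ‖iteratedFDeriv ℝ (i + 2) (fun W => Qd m δ (F (LamInv m δ W))) Z‖ ≤ ε := by
  have hle : ((i + 2 : ℕ) : WithTop ℕ∞) ≤ ((⊤ : ℕ∞) : WithTop ℕ∞) := by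
    exact WithTop.coe_le_coe.2 (le_top : ((i + 2 : ℕ) : ℕ∞) ≤ ⊤)
  have hc : Continuous (iteratedFDeriv ℝ (i + 2) F) := hF.continuous_iteratedFDeriv hle
  obtain ⟨M, hM⟩ := (isCompact_closedBall (0 : Em m) R).exists_bound_of_continuousOn
    hc.continuousOn
  have hM0 : 0 ≤ M := (norm_nonneg _).trans (hM 0 (by simp [hR.le]))
  refine ⟨min 1 (ε / (M + 1)), by positivity, fun δ hδ hs Z hZ => ?_⟩
  have h1 : Real.sqrt δ < 1 := hs.trans_le (min_le_left _ _)
  have h2 : Real.sqrt δ < ε / (M + 1) := hs.trans_le (min_le_right _ _)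
  have hs0 := Real.sqrt_pos.2 hδ
  have hFL : ContDiff ℝ (⊤ : ℕ∞) (fun W => F (LamInv m δ W)) :=
    hF.comp (LamInv m δ).contDiff
  have a1 : iteratedFDeriv ℝ (i + 2) (fun W => Qd m δ (F (LamInv m δ W))) Z
      = (Qd m δ).compContinuousMultilinearMap
        (iteratedFDeriv ℝ (i + 2) (fun W => F (LamInv m δ W)) Z) :=
    (Qd m δ).iteratedFDeriv_comp_left (hFL.contDiffAt) hle
  have a2 : iteratedFDeriv ℝ (i + 2) (fun W => F (LamInv m δ W)) Z
      = (iteratedFDeriv ℝ (i + 2) F (LamInv m δ Z)).compContinuousLinearMap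
        (fun _ => LamInv m δ) :=
    (LamInv m δ).iteratedFDeriv_comp_right hF Z hle
  rw [a1, a2]
  have hL : LamInv m δ Z ∈ Metric.closedBall (0 : Em m) R := by
    rw [mem_closedBall_zero_iff]
    exact (norm_LamInv_apply_le m δ hδ h1 hZ).trans (by nlinarith)
  have b1 := (iteratedFDeriv ℝ (i + 2) F (LamInv m δ Z)).norm_compContinuousLinearMap_le
        (fun _ => LamInv m δ)
  rw [Finset.prod_const, Finset.card_univ, Fintype.card_fin] at b1
  calc _ ≤ ‖Qd m δ‖ * _ := ContinuousLinearMap.norm_compContinuousMultilinearMap_le _ _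
    _ ≤ (Real.sqrt δ)⁻¹ * (M * (Real.sqrt δ) ^ (i + 2)) := by
        refine mul_le_mul (norm_Qd_le m δ hδ h1) (b1.trans ?_) (norm_nonneg _) (by positivity)
        exact mul_le_mul (hM _ hL) (pow_le_pow_left₀ (norm_nonneg _)
          (norm_LamInv_le m δ hδ h1) _) (by positivity) hM0
    _ = M * (Real.sqrt δ) * (Real.sqrt δ) ^ i := by
        rw [pow_add]
        field_simp
    _ ≤ M * Real.sqrt δ * 1 := by
        gcongr
        exact pow_le_one₀ hs0.le h1.le
    _ ≤ ε := by
        rw [lt_div_iff₀ (by positivity)] at h2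
        nlinarith

/-- First derivative. -/
lemma first_order (m : ℕ) (F : Em m → (Em m →L[ℝ] Em m)) (hF : ContDiff ℝ (⊤ : ℕ∞) F)
    (hline : ∀ ζ c : ℂ, F ((0 : Fin m → ℂ), ζ) ((0 : Fin m → ℂ), c) = 0)
    (R : ℝ) (hR : 0 < R) (ε : ℝ) (hε : 0 < ε) :
    ∃ s₀ > 0, ∀ δ : ℝ, 0 < δ → Real.sqrt δ < s₀ → ∀ Z : Em m, ‖Z‖ ≤ R →
      ‖fderiv ℝ (fun W => Qd m δ (F (LamInv m δ W))) Z‖ ≤ ε := by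
  have hd : Differentiable ℝ F := hF.differentiable (by simp)
  have hc : Continuous (fderiv ℝ F) := hF.continuous_fderiv (by simp)
  -- the derivative of `F` at `0` along the line kills the line
  have hker : ∀ b c : ℂ, fderiv ℝ F 0 ((0 : Fin m → ℂ), b) ((0 : Fin m → ℂ), c) = 0 := by
    intro b c
    let p : ℂ →L[ℝ] Em m := ContinuousLinearMap.inr ℝ (Fin m → ℂ) ℂ
    have hd0 : HasFDerivAt F (fderiv ℝ F 0) (p 0) := by
      rw [map_zero]; exact (hd 0).hasFDerivAt
    have h1 : HasFDerivAt (fun ζ : ℂ => F (p ζ)) ((fderiv ℝ F 0).comp p) 0 :=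
      hd0.comp (0 : ℂ) p.hasFDerivAt
    have h2 := ((ContinuousLinearMap.apply ℝ (Em m) (((0 : Fin m → ℂ), c) : Em m)).hasFDerivAt
      (x := F (p 0))).comp (0 : ℂ) h1
    have h3 : HasFDerivAt (fun _ : ℂ => (0 : Em m)) (0 : ℂ →L[ℝ] Em m) 0 :=
      hasFDerivAt_const _ _
    have e : ((ContinuousLinearMap.apply ℝ (Em m) (((0 : Fin m → ℂ), c) : Em m)) ∘
        (fun ζ : ℂ => F (p ζ))) = fun _ : ℂ => (0 : Em m) := by
      funext ζ
      exact hline ζ c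
    rw [e] at h2
    have := congrArg (fun T => T b) (h2.unique h3)
    exact this
  set C := ‖fderiv ℝ F 0‖ with hC
  have hC0 : 0 ≤ C := norm_nonneg (fderiv ℝ F 0)
  have hc0 : ContinuousAt (fderiv ℝ F) (0 : Em m) := hc.continuousAt
  obtain ⟨r, hr, hcr⟩ := (Metric.continuousAt_iff (f := fderiv ℝ F) (a := (0 : Em m))).1 hc0
    (ε / 2) (by positivity)
  refine ⟨min 1 (min (r / R) (ε / (4 * (C + 1)))), by positivity, fun δ hδ hs Z hZ => ?_⟩
  have h1 : Real.sqrt δ < 1 := hs.trans_le (min_le_left _ _)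
  have h2 : Real.sqrt δ < r / R := hs.trans_le ((min_le_right _ _).trans (min_le_left _ _))
  have h3 : Real.sqrt δ < ε / (4 * (C + 1)) :=
    hs.trans_le ((min_le_right _ _).trans (min_le_right _ _))
  have hs0 := Real.sqrt_pos.2 hδ
  have hss : Real.sqrt δ * Real.sqrt δ = δ := Real.mul_self_sqrt hδ.le
  have hfd : HasFDerivAt (fun W => Qd m δ (F (LamInv m δ W)))
      ((Qd m δ).comp ((fderiv ℝ F (LamInv m δ Z)).comp (LamInv m δ))) Z :=
    (Qd m δ).hasFDerivAt.comp Z ((hd _).hasFDerivAt.comp Z (LamInv m δ).hasFDerivAt)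
  rw [hfd.fderiv]
  refine ContinuousLinearMap.opNorm_le_bound _ hε.le fun v => ?_
  simp only [ContinuousLinearMap.comp_apply]
  have hD : ‖fderiv ℝ F (LamInv m δ Z) - fderiv ℝ F 0‖ ≤ ε / 2 := by
    refine (dist_eq_norm (fderiv ℝ F (LamInv m δ Z)) (fderiv ℝ F 0)).symm.le.trans ?_
    refine (hcr ?_).le
    rw [dist_zero_right]
    refine (norm_LamInv_apply_le m δ hδ h1 hZ).trans_lt ?_
    rwa [lt_div_iff₀ hR] at h2
  have hsplit : fderiv ℝ F (LamInv m δ Z) (LamInv m δ v)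
      = (fderiv ℝ F (LamInv m δ Z) - fderiv ℝ F 0) (LamInv m δ v)
        + (δ • fderiv ℝ F 0 (v.1, (0 : ℂ))
          + Real.sqrt δ • fderiv ℝ F 0 ((0 : Fin m → ℂ), v.2)) := by
    have e : LamInv m δ v = δ • (v.1, (0 : ℂ)) + Real.sqrt δ • ((0 : Fin m → ℂ), v.2) := by
      rw [LamInv_apply]; simp
    rw [← map_smul, ← map_smul, ← map_add, ← e, ContinuousLinearMap.sub_apply, sub_add_cancel]
  have hv1 : ‖((v.1, (0 : ℂ)) : Em m)‖ ≤ ‖v‖ := by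
    rw [Prod.norm_mk, norm_zero]; exact max_le (norm_fst_le v) (norm_nonneg _)
  have hv2 : ‖(((0 : Fin m → ℂ), v.2) : Em m)‖ ≤ ‖v‖ := by
    rw [Prod.norm_mk, norm_zero]; exact max_le (norm_nonneg _) (norm_snd_le v)
  have t1 : ‖Qd m δ ((fderiv ℝ F (LamInv m δ Z) - fderiv ℝ F 0) (LamInv m δ v))‖
      ≤ ε / 2 * ‖v‖ := by
    calc _ ≤ (Real.sqrt δ)⁻¹ * (ε / 2 * (Real.sqrt δ * ‖v‖)) := by
          refine (norm_Qd_apply_le m δ hδ h1 _).trans ?_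
          refine mul_le_mul_of_nonneg_left ?_ (by positivity)
          refine (ContinuousLinearMap.le_opNorm _ _).trans ?_
          exact mul_le_mul hD (norm_LamInv_apply_le m δ hδ h1 le_rfl) (norm_nonneg _)
            (by positivity)
      _ = ε / 2 * ‖v‖ := by field_simp
  have t2 : ‖Qd m δ (δ • fderiv ℝ F 0 (v.1, (0 : ℂ)))‖ ≤ Real.sqrt δ * (C * ‖v‖) := by
    rw [map_smul, norm_smul, Real.norm_of_nonneg hδ.le]
    calc _ ≤ δ * ((Real.sqrt δ)⁻¹ * (C * ‖v‖)) := by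
          refine mul_le_mul_of_nonneg_left ?_ hδ.le
          refine (norm_Qd_apply_le m δ hδ h1 _).trans ?_
          refine mul_le_mul_of_nonneg_left ?_ (by positivity)
          exact (ContinuousLinearMap.le_opNorm _ _).trans (mul_le_mul_of_nonneg_left hv1 hC0)
      _ = Real.sqrt δ * (C * ‖v‖) := by
          nth_rewrite 1 [← hss]
          field_simp
  have t3 : ‖Qd m δ (Real.sqrt δ • fderiv ℝ F 0 ((0 : Fin m → ℂ), v.2))‖
      ≤ Real.sqrt δ * (C * ‖v‖) := by
    rw [map_smul, norm_smul, Real.norm_of_nonneg hs0.le]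
    refine mul_le_mul_of_nonneg_left ?_ hs0.le
    refine (norm_Qd_apply_le_of_ker m δ hδ h1 _ (hker v.2)).trans ?_
    exact (ContinuousLinearMap.le_opNorm _ _).trans (mul_le_mul_of_nonneg_left hv2 hC0)
  rw [hsplit, map_add, map_add]
  refine (norm_add_le _ _).trans ((add_le_add t1 ((norm_add_le _ _).trans
    (add_le_add t2 t3))).trans ?_)
  rw [lt_div_iff₀ (by positivity)] at h3
  have h4 : Real.sqrt δ * C ≤ ε / 4 := by nlinarith
  nlinarith [norm_nonneg v]

/-- Order zero, from order one. -/
lemma zero_order (m : ℕ) (F : Em m → (Em m →L[ℝ] Em m)) (hF : ContDiff ℝ (⊤ : ℕ∞) F)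
    (hF0 : F 0 = 0)
    (hline : ∀ ζ c : ℂ, F ((0 : Fin m → ℂ), ζ) ((0 : Fin m → ℂ), c) = 0)
    (R : ℝ) (hR : 0 < R) (ε : ℝ) (hε : 0 < ε) :
    ∃ s₀ > 0, ∀ δ : ℝ, 0 < δ → Real.sqrt δ < s₀ → ∀ Z : Em m, ‖Z‖ ≤ R →
      ‖Qd m δ (F (LamInv m δ Z))‖ ≤ ε := by
  obtain ⟨s₀, hs₀, H⟩ := first_order m F hF hline R hR (ε / R) (by positivity)
  refine ⟨s₀, hs₀, fun δ hδ hs Z hZ => ?_⟩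
  have hd : Differentiable ℝ F := hF.differentiable (by simp)
  have hdd : Differentiable ℝ (fun W => Qd m δ (F (LamInv m δ W))) :=
    (Qd m δ).differentiable.comp (hd.comp (LamInv m δ).differentiable)
  have := (convex_closedBall (0 : Em m) R).norm_image_sub_le_of_norm_fderiv_le (𝕜 := ℝ)
    (f := fun W => Qd m δ (F (LamInv m δ W))) (C := ε / R) (x := 0) (y := Z)
    (fun x _ => hdd x) (fun x hx => H δ hδ hs x (mem_closedBall_zero_iff.1 hx))
    (by simp [hR.le]) (mem_closedBall_zero_iff.2 hZ)
  simp only [map_zero, hF0, sub_zero] at this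
  refine this.trans ?_
  calc _ ≤ ε / R * R := mul_le_mul_of_nonneg_left hZ (by positivity)
    _ = ε := by field_simp

lemma each_order (m : ℕ) (F : Em m → (Em m →L[ℝ] Em m)) (hF : ContDiff ℝ (⊤ : ℕ∞) F)
    (hF0 : F 0 = 0)
    (hline : ∀ ζ c : ℂ, F ((0 : Fin m → ℂ), ζ) ((0 : Fin m → ℂ), c) = 0)
    (i : ℕ) (R : ℝ) (hR : 0 < R) (ε : ℝ) (hε : 0 < ε) :
    ∃ s₀ > 0, ∀ δ : ℝ, 0 < δ → Real.sqrt δ < s₀ → ∀ Z : Em m, ‖Z‖ ≤ R →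
      ‖iteratedFDeriv ℝ i (fun W => Qd m δ (F (LamInv m δ W))) Z‖ ≤ ε := by
  rcases i with _ | _ | i
  · simpa only [norm_iteratedFDeriv_zero] using zero_order m F hF hF0 hline R hR ε hε
  · obtain ⟨s₀, hs₀, H⟩ := first_order m F hF hline R hR ε hε
    refine ⟨s₀, hs₀, fun δ hδ hs Z hZ => ?_⟩
    have e := norm_iteratedFDeriv_one (𝕜 := ℝ) (f := fun W => Qd m δ (F (LamInv m δ W))) (x := Z)
    exact e.le.trans (H δ hδ hs Z hZ)
  · exact high_order m F hF i R hR ε hε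

/-- if `J = J_st + O(|Z|)` is smooth, and the line
`l = {(0,ζ)}` is `J`-holomorphic, then under the non-isotropic dilations
`Λ_δ(z,w) = (δ⁻¹z, δ^{−1/2}w)` the structures `J_δ = (Λ_δ)_*(J)` converge to
`J_st` in `C^k` norm on every compact subset, for every `k`, as `δ → 0`. -/
theorem stmt_15 (m : ℕ)
    (J : Em m → (Em m →L[ℝ] Em m))
    (hJs : ContDiff ℝ (⊤ : ℕ∞) J)
    (hACS : ∀ Z, (J Z).comp (J Z) = -ContinuousLinearMap.id ℝ (Em m))
    (hJ0 : J 0 = JstE m)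
    (hline : ∀ ζ c : ℂ, J ((0 : Fin m → ℂ), ζ) ((0 : Fin m → ℂ), c)
      = ((0 : Fin m → ℂ), Complex.I * c)) :
    ∀ k : ℕ, ∀ K : Set (Em m), IsCompact K → ∀ ε > 0, ∃ δ₀ > 0,
      ∀ δ : ℝ, 0 < δ → δ < δ₀ → ∀ i ≤ k, ∀ Z ∈ K,
        ‖iteratedFDeriv ℝ i (fun W => Jdelta m J δ W - JstE m) Z‖ ≤ ε := by
  intro k K hK ε hε
  obtain ⟨R, hR, hKR⟩ : ∃ R : ℝ, 0 < R ∧ ∀ Z ∈ K, ‖Z‖ ≤ R := by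
    obtain ⟨R, hR, h⟩ := hK.isBounded.exists_pos_norm_le
    exact ⟨R, hR, h⟩
  have hF : ContDiff ℝ (⊤ : ℕ∞) (fun W => J W - JstE m) := hJs.sub contDiff_const
  have hF0 : (fun W => J W - JstE m) 0 = 0 := by simp [hJ0]
  have hl : ∀ ζ c : ℂ, (fun W => J W - JstE m) ((0 : Fin m → ℂ), ζ) ((0 : Fin m → ℂ), c) = 0 := by
    intro ζ c
    simp only [ContinuousLinearMap.sub_apply, hline, JstE, ContinuousLinearMap.smul_apply,
      ContinuousLinearMap.id_apply, Prod.smul_mk, smul_zero, smul_eq_mul, sub_self]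
  choose s hs H using fun i : ℕ =>
    each_order m (fun W => J W - JstE m) hF hF0 hl i R hR ε hε
  obtain ⟨t, ht, hts⟩ : ∃ t : ℝ, 0 < t ∧ ∀ i ≤ k, t ≤ s i := by
    have hne : (Finset.range (k + 1)).Nonempty := ⟨0, by simp⟩
    obtain ⟨j, -, hj⟩ := Finset.exists_min_image (Finset.range (k + 1)) s hne
    exact ⟨s j, hs j, fun i hi => hj i (by simpa using Nat.lt_succ_of_le hi)⟩
  refine ⟨t ^ 2, by positivity, fun δ hδ hδt i hi Z hZ => ?_⟩
  rw [Jdelta_sub_eq m J δ hδ]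
  exact H i δ hδ (((Real.sqrt_lt' ht).2 hδt).trans_le (hts i hi)) Z (hKR Z hZ)
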